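/- Let S be a semigroup, σ : S → S an involutive automorphism, and μ a finite linear combination of Dirac measures at central points, given by a finite index set I, constants c_i ∈ ℂ, and elements z_i ∈ Z(S). The pairs f, g : S → ℂ with g ≠ 0 satisfying ∑_{i∈I} c_i f(x y z_i) + ∑_{i∈I} c_i f(σ(y) x z_i) = 2 f(x) g(y) for all x, y ∈ S are exactly the following: (1) f = 0 and g ≠ 0 arbitrary; (2) f = λ₂ m and g = (∑_{i∈I} c_i m(z_i)) · (m + m*)/2, where m : S → ℂ is multiplicative, λ₂ ∈ ℂ \ {0}, and ∑_{i∈I} c_i m(z_i) ≠ 0; (3) f = α₁ χ + β₁ χ* and g = (∑_{i∈I} c_i χ(z_i)) · (χ + χ*)/2, where χ : S → ℂ is multiplicative, α₁, β₁ ∈ ℂ with (α₁, β₁) ≠ (0, 0), χ ≠ χ*, ∑_{i∈I} c_i χ(z_i) = ∑_{i∈I} c_i χ*(z_i), and ∑_{i∈I} c_i χ(z_i) ≠ 0; (4) f = λ(γ₁ χ + φ) and g = (∑_{i∈I} c_i χ(z_i)) χ, where χ : S → ℂ is a nonzero multiplicative function, φ is a nonzero solution of the special sine addition law φ(xy) =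 φ(x)χ(y) + φ(y)χ(x), λ ∈ ℂ \ {0}, γ₁ ∈ ℂ, χ* = χ, φ* = −φ, ∑_{i∈I} c_i χ(z_i) ≠ 0, and ∑_{i∈I} c_i φ(z_i) = 0. -/

import Mathlib

namespace KW

lemma exists_ne {S : Type*} {f : S → ℂ} (hf : f ≠ 0) : ∃ x, f x ≠ 0 := by
  by_contra h
  push Not at h
  exact hf (funext h)

/-- A function translating by `u` on the right and by `v` on the left. -/
lemma twoside {S : Type*} [Semigroup S] {A u v : S → ℂ} (hA : A ≠ 0) (hu : u ≠ 0)
    (h1 : ∀ x y, A (x * y) = A x * u y) (h2 : ∀ x y, A (x * y) = A y * v x) :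
    (∃ k : ℂ, k ≠ 0 ∧ ∀ x, A x = k * u x) ∧ ∀ x, v x = u x := by
  obtain ⟨a, ha⟩ := exists_ne hA
  obtain ⟨b, hb⟩ := exists_ne hu
  have h3 : ∀ x y, A x * u y = A y * v x := fun x y => by rw [← h1, h2]
  have hva : v a ≠ 0 := by
    intro h0
    have := h3 a b
    rw [h0, mul_zero] at this
    exact (mul_ne_zero ha hb) this
  have hk : ∀ x, A x = (A a / v a) * u x := by
    intro x
    have := h3 a x
    field_simp
    linear_combination -this
  have hk0 : A a / v a ≠ 0 := div_ne_zero ha hva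
  refine ⟨⟨_, hk0, hk⟩, ?_⟩
  intro x
  have := h3 x b
  rw [hk x, hk b] at this
  have h4 : (A a / v a * u b) * (v x - u x) = 0 := by linear_combination -this
  rcases mul_eq_zero.1 h4 with h | h
  · exact absurd h (mul_ne_zero hk0 hb)
  · linear_combination h

/-- Distinct nonzero multiplicative functions are linearly independent. -/
lemma indep {S : Type*} [Semigroup S] {χ ψ : S → ℂ} (hχ : ∀ x y, χ (x * y) = χ x * χ y)
    (hψ : ∀ x y, ψ (x * y) = ψ x * ψ y) (hχ0 : χ ≠ 0) (hψ0 : ψ ≠ 0) (hne : χ ≠ ψ)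
    {a b : ℂ} (h : ∀ x, a * χ x + b * ψ x = 0) : a = 0 ∧ b = 0 := by
  obtain ⟨w, hw⟩ : ∃ w, χ w - ψ w ≠ 0 := by
    by_contra hh
    push Not at hh
    exact hne (funext fun x => sub_eq_zero.1 (hh x))
  obtain ⟨u, hu⟩ := exists_ne hχ0
  obtain ⟨v, hv⟩ := exists_ne hψ0
  constructor
  · have e : a * (χ u * (χ w - ψ w)) = 0 := by
      have := h (u * w)
      rw [hχ, hψ] at this
      linear_combination this - ψ w * h u
    exact (mul_eq_zero.1 e).resolve_right (mul_ne_zero hu hw)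
  · have e : b * (ψ v * (χ w - ψ w)) = 0 := by
      have := h (v * w)
      rw [hχ, hψ] at this
      linear_combination -this + χ w * h v
    exact (mul_eq_zero.1 e).resolve_right (mul_ne_zero hv hw)

/-- Structure of `f` once `h` and the defects are diagonalised. -/
lemma split {S : Type*} [Semigroup S] (σ : S → S)
    (hσmul : ∀ x y : S, σ (x * y) = σ x * σ y) (hσinv : ∀ x : S, σ (σ x) = x)
    {f A B χ ψ : S → ℂ} (hf : f ≠ 0) (hχ : ∀ x y, χ (x * y) = χ x * χ y)
    (hψ : ∀ x y, ψ (x * y) = ψ x * ψ y) (hχ0 : χ ≠ 0) (hψ0 : ψ ≠ 0) (hne : χ ≠ ψ)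
    (hfAB : ∀ x, f x = A x + B x)
    (h1 : ∀ x y, f (x * y) = A x * χ y + B x * ψ y)
    (h2 : ∀ x y, f (σ y * x) = B x * χ y + A x * ψ y) :
    (∀ x, ψ x = χ (σ x)) ∧ ∃ k l : ℂ, ∀ x, f x = k * χ x + l * ψ x := by
  have hR : ∀ x y, A (x * y) = A x * χ y ∧ B (x * y) = B x * ψ y := by
    intro x y
    have := @indep S _ χ ψ hχ hψ hχ0 hψ0 hne (A (x * y) - A x * χ y) (B (x * y) - B x * ψ y) (by
      intro z
      have e := h1 (x * y) z
      rw [mul_assoc, h1, hχ, hψ] at e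
      linear_combination -e)
    exact ⟨sub_eq_zero.1 this.1, sub_eq_zero.1 this.2⟩
  have hL : ∀ x y, B (σ y * x) = B x * χ y ∧ A (σ y * x) = A x * ψ y := by
    intro x y
    have := @indep S _ χ ψ hχ hψ hχ0 hψ0 hne (B (σ y * x) - B x * χ y) (A (σ y * x) - A x * ψ y) (by
      intro z
      have e := h2 (σ y * x) z
      rw [← mul_assoc, ← hσmul, h2, hχ, hψ] at e
      linear_combination -e)
    exact ⟨sub_eq_zero.1 this.1, sub_eq_zero.1 this.2⟩
  have hLA : ∀ x y, A (x * y) = A y * ψ (σ x) := fun x y => by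
    have := (hL y (σ x)).2
    rwa [hσinv] at this
  have hLB : ∀ x y, B (x * y) = B y * χ (σ x) := fun x y => by
    have := (hL y (σ x)).1
    rwa [hσinv] at this
  have hA : A ≠ 0 → _ := fun hA => twoside hA hχ0 (fun x y => (hR x y).1) hLA
  have hB : B ≠ 0 → _ := fun hB => twoside hB hψ0 (fun x y => (hR x y).2) hLB
  constructor
  · by_cases hA0 : A = 0
    · have hB0 : B ≠ 0 := by
        rintro rfl
        subst hA0
        exact hf (funext fun x => by simp [hfAB])
      intro x
      exact ((hB hB0).2 x).symm
    · intro x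
      have := (hA hA0).2 (σ x)
      rwa [hσinv] at this
  · have eA : ∃ k : ℂ, ∀ x, A x = k * χ x := by
      by_cases hA0 : A = 0
      · exact ⟨0, fun x => by simp [hA0]⟩
      · obtain ⟨⟨k, _, hk⟩, _⟩ := hA hA0
        exact ⟨k, hk⟩
    have eB : ∃ k : ℂ, ∀ x, B x = k * ψ x := by
      by_cases hB0 : B = 0
      · exact ⟨0, fun x => by simp [hB0]⟩
      · obtain ⟨⟨k, _, hk⟩, _⟩ := hB hB0
        exact ⟨k, hk⟩
    obtain ⟨k, hk⟩ := eA
    obtain ⟨l, hl⟩ := eB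
    exact ⟨k, l, fun x => by rw [hfAB, hk, hl]⟩

/-- The degenerate case, one of the two multiplicative functions vanishing. -/
lemma degenerate {S : Type*} [Semigroup S] (σ : S → S)
    (hσmul : ∀ x y : S, σ (x * y) = σ x * σ y) (hσinv : ∀ x : S, σ (σ x) = x)
    {f A B χ : S → ℂ} (hf : f ≠ 0) (hχ : ∀ x y, χ (x * y) = χ x * χ y) (hχ0 : χ ≠ 0)
    (hfAB : ∀ x, f x = A x + B x)
    (h1 : ∀ x y, f (x * y) = A x * χ y)
    (h2 : ∀ x y, f (σ y * x) = B x * χ y) : False := by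
  obtain ⟨a, ha⟩ := exists_ne hχ0
  have h3 : ∀ x y, A y * χ x = B x * χ (σ y) := fun x y => by
    rw [← h1, ← h2, hσinv]
  have hA : ∀ y, A y = (B a / χ a) * χ (σ y) := fun y => by
    have := h3 a y
    field_simp
    linear_combination this
  generalize B a / χ a = k at hA
  have hB : ∀ x, B x = k * χ x := fun x => by
    have := h3 x (σ a)
    rw [hA, hσinv] at this
    apply mul_right_cancel₀ ha
    linear_combination -this
  have e : ∀ x y, k * χ (σ x) * χ y = k * χ (σ x) * χ (σ y) + k * χ x * χ y := fun x y => by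
    have := h1 x y
    rw [hfAB, hA, hB, hA, hσmul, hχ, hχ] at this
    linear_combination -this
  have hk : k ≠ 0 := by
    rintro rfl
    exact hf (funext fun x => by simp [hfAB, hA, hB])
  have e' : ∀ x y, χ (σ x) * χ y = χ (σ x) * χ (σ y) + χ x * χ y := fun x y => by
    apply mul_left_cancel₀ hk
    linear_combination e x y
  have e1 := e' a a
  have e2 := e' (σ a) a
  have e3 := e' a (σ a)
  have e4 := e' (σ a) (σ a)
  simp only [hσinv] at e1 e2 e3 e4
  have : χ a * χ a = 0 := by linear_combination e2 - (2 / 3) * (e1 + e2 + e3)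
  exact ha (mul_self_eq_zero.1 this)

/-- The variant of Wilson's equation. -/
lemma wilson {S : Type*} [Semigroup S] (σ : S → S)
    (hσmul : ∀ x y : S, σ (x * y) = σ x * σ y) (hσinv : ∀ x : S, σ (σ x) = x)
    {f h : S → ℂ} (hf : f ≠ 0) (hh : h ≠ 0)
    (E : ∀ x y, f (x * y) + f (σ y * x) = 2 * f x * h y) :
    (∃ (χ : S → ℂ) (k l : ℂ), (∀ x y, χ (x * y) = χ x * χ y) ∧ (l ≠ 0 → χ ≠ fun x => χ (σ x)) ∧
      (∀ x, f x = k * χ x + l * χ (σ x)) ∧ ∀ x, h x = (χ x + χ (σ x)) / 2) ∨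
    (∃ (χ φ : S → ℂ) (γ : ℂ), (∀ x y, χ (x * y) = χ x * χ y) ∧ χ ≠ 0 ∧ φ ≠ 0 ∧
      (∀ x y, φ (x * y) = φ x * χ y + φ y * χ x) ∧ (∀ x, χ (σ x) = χ x) ∧
      (∀ x, φ (σ x) = -φ x) ∧ (∀ x, f x = γ * χ x + φ x) ∧ ∀ x, h x = χ x) := by
  have W : ∀ x y z, f (x * y * z) =
      f x * h (y * z) + f (x * y) * h z + f (x * z) * h y - 2 * f x * h y * h z := by
    intro x y z
    have e1 := E x (y * z)
    have e2 := E (σ z * x) y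
    have e3 := E (x * y) z
    have e4 := E x z
    rw [hσmul] at e1
    simp only [mul_assoc] at e1 e2 e3 e4 ⊢
    linear_combination e1 / 2 - e2 / 2 + e3 / 2 - h y * e4
  set F : S → S → ℂ := fun x y => f (x * y) - f x * h y with hF
  have hFr : ∀ x y, f (x * y) = f x * h y + F x y := fun x y => by simp [hF]
  have hFl : ∀ x y, f (σ y * x) = f x * h y - F x y := fun x y => by
    have := E x y
    simp only [hF]
    linear_combination this
  have hFs : ∀ x y z, F x (y * z) = F x y * h z + F x z * h y := fun x y z => by
    simp only [hF]
    rw [← mul_assoc, W]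
    ring
  clear_value F
  obtain ⟨a, ha⟩ := exists_ne hf
  by_cases hF0 : ∀ x y, F x y = 0
  · left
    have h1 : ∀ x y, f (x * y) = f x * h y := fun x y => by rw [hFr, hF0, add_zero]
    have h2 : ∀ x y, f (x * y) = f y * h (σ x) := fun x y => by
      have := hFl y (σ x)
      rwa [hF0, sub_zero, hσinv] at this
    obtain ⟨⟨k, hk, hfk⟩, hs⟩ := twoside hf hh h1 h2
    refine ⟨h, k, 0, ?_, by simp, by simpa using hfk, fun x => by simp [hs]⟩
    intro x y
    have e := h1 (a * x) y
    rw [mul_assoc, h1, h1] at e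
    apply mul_left_cancel₀ ha
    linear_combination e
  push Not at hF0
  obtain ⟨x0, z0, hxz⟩ := hF0
  have key : ∀ x u y w, F x w * (h (u * y) - h u * h y) = F x u * (h (y * w) - h y * h w) := by
    intro x u y w
    have e1 := hFs x (u * y) w
    have e2 := hFs x u (y * w)
    rw [← mul_assoc, e1, hFs, hFs] at e2
    linear_combination e2
  obtain ⟨d, hd⟩ : ∃ d : ℂ, ∀ x y, h (x * y) = h x * h y + d * F x0 x * F x0 y := by
    refine ⟨(h (z0 * z0) - h z0 * h z0) / (F x0 z0 * F x0 z0), ?_⟩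
    intro x y
    have e1 := key x0 x y z0
    have e2 := key x0 y z0 z0
    have hz2 : F x0 z0 * F x0 z0 ≠ 0 := mul_ne_zero hxz hxz
    apply mul_left_cancel₀ hz2
    field_simp
    linear_combination F x0 z0 * e1 + F x0 x * e2
  obtain ⟨δ, hδ⟩ : ∃ δ : ℂ, δ * δ = d := ⟨d ^ (1 / 2 : ℂ), by
    rw [← sq]
    have := Complex.cpow_nat_inv_pow d (two_ne_zero)
    simpa using this⟩
  by_cases hδ0 : δ = 0
  · -- parabolic case
    right
    have hm : ∀ x y, h (x * y) = h x * h y := fun x y => by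
      rw [hd, ← hδ, hδ0]; ring
    have hR : ∀ y x z, F (x * z) y = F x y * h z := fun y x z => by
      have e := hFr (x * z) y
      rw [mul_assoc, hFr, hFr, hFs, hm] at e
      linear_combination -e
    have hL : ∀ y x z, F (σ z * x) y = F x y * h z := fun y x z => by
      have e := hFl (σ z * x) y
      rw [← mul_assoc, ← hσmul, hFl, hFl, hFs, hm] at e
      linear_combination e
    have hL' : ∀ y x z, F (x * z) y = F z y * h (σ x) := fun y x z => by
      have := hL y z (σ x)
      rwa [hσinv] at this
    have hs : ∀ x, h (σ x) = h x :=
      (twoside (A := fun x => F x z0) (fun h0 => hxz (congrFun h0 x0)) hh (hR z0) (hL' z0)).2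
    have hψ : ∀ y, ∃ k : ℂ, ∀ x, F x y = k * h x := by
      intro y
      by_cases hy : (fun x => F x y) = 0
      · exact ⟨0, fun x => by simpa using congrFun hy x⟩
      · obtain ⟨⟨k, _, hk⟩, _⟩ := twoside (A := fun x => F x y) hy hh (hR y) (hL' y)
        exact ⟨k, hk⟩
    choose ψ hψ using hψ
    obtain ⟨b, hb⟩ := exists_ne hh
    have e1 : ∀ x y, h x * ψ (σ y) = - (h y * ψ x) + f x * h y - f y * h x := fun x y => by
      have e := hFl x (σ y)
      rw [hσinv, hFr, hs, hψ, hψ] at e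
      linear_combination e
    have hγ : ∃ γ : ℂ, ∀ x, f x = γ * h x + ψ x := by
      refine ⟨(ψ (σ b) + f b) / h b, fun x => ?_⟩
      have := e1 x b
      field_simp
      linear_combination -this
    obtain ⟨γ, hγ⟩ := hγ
    refine ⟨h, ψ, γ, hm, hh, ?_, ?_, hs, ?_, hγ, fun _ => rfl⟩
    · rintro rfl
      exact hxz (by simp [hψ])
    · intro x y
      apply mul_right_cancel₀ hb
      have := hFs b x y
      rw [hψ, hψ, hψ] at this
      linear_combination this
    · intro y
      apply mul_right_cancel₀ hb
      have := e1 b y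
      rw [hγ, hγ] at this
      linear_combination this
  · left
    have hd0 : d ≠ 0 := by rw [← hδ]; exact mul_ne_zero hδ0 hδ0
    set φ := F x0 with hφ
    have hc : ∃ c : S → ℂ, ∀ x y, F x y = c x * φ y := by
      refine ⟨fun x => F x z0 / φ z0, fun x y => ?_⟩
      have e := key x y z0 z0
      rw [hd, hd] at e
      have hne : d * φ z0 ≠ 0 := mul_ne_zero hd0 hxz
      have : d * φ z0 * (F x y * φ z0 - F x z0 * φ y) = 0 := by linear_combination -e
      have := (mul_eq_zero.1 this).resolve_left hne
      field_simp
      linear_combination this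
    obtain ⟨c, hc⟩ := hc
    have hφs : ∀ x y, φ (x * y) = φ x * h y + φ y * h x := hFs x0
    let χ : S → ℂ := fun x => h x + δ * φ x
    let ψ : S → ℂ := fun x => h x - δ * φ x
    let A : S → ℂ := fun x => (f x + c x / δ) / 2
    let B : S → ℂ := fun x => (f x - c x / δ) / 2
    have hχ : ∀ x y, χ (x * y) = χ x * χ y := fun x y => by
      simp only [χ, hd, hφs, ← hδ]; ring
    have hψ : ∀ x y, ψ (x * y) = ψ x * ψ y := fun x y => by
      simp only [ψ, hd, hφs, ← hδ]; ring
    have hfAB : ∀ x, f x = A x + B x := fun x => by simp only [A, B]; ring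
    have h1 : ∀ x y, f (x * y) = A x * χ y + B x * ψ y := fun x y => by
      rw [hFr, hc]; simp only [A, B, χ, ψ]; field_simp; ring
    have h2 : ∀ x y, f (σ y * x) = B x * χ y + A x * ψ y := fun x y => by
      rw [hFl, hc]; simp only [A, B, χ, ψ]; field_simp; ring
    have hne : χ ≠ ψ := by
      intro e
      have := congrFun e z0
      simp only [χ, ψ] at this
      have : δ * φ z0 = 0 := by linear_combination this / 2
      exact (mul_ne_zero hδ0 hxz) this
    have hhχ : ∀ x, h x = (χ x + ψ x) / 2 := fun x => by simp only [χ, ψ]; ring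
    clear_value χ ψ A B
    by_cases hχ0 : χ = 0
    · have hψ0 : ψ ≠ 0 := fun e => hne (hχ0.trans e.symm)
      exact (degenerate σ hσmul hσinv (A := B) (B := A) hf hψ hψ0
        (fun x => by rw [hfAB, add_comm])
        (fun x y => by rw [h1, hχ0]; simp) (fun x y => by rw [h2, hχ0]; simp)).elim
    by_cases hψ0 : ψ = 0
    · exact (degenerate σ hσmul hσinv (A := A) (B := B) hf hχ hχ0 hfAB
        (fun x y => by rw [h1, hψ0]; simp) (fun x y => by rw [h2, hψ0]; simp)).elim
    obtain ⟨hs, k, l, hkl⟩ := split σ hσmul hσinv hf hχ hψ hχ0 hψ0 hne hfAB h1 h2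
    refine ⟨χ, k, l, hχ, fun _ e => hne (e.trans (funext fun x => (hs x).symm)), ?_, ?_⟩
    · intro x; rw [hkl, hs]
    · intro x; rw [hhχ, hs]

/-- The averaging operator. -/
noncomputable def T {S : Type*} [Semigroup S] {ι : Type*} [Fintype ι] (c : ι → ℂ) (z : ι → S)
    (h : S → ℂ) : S → ℂ := fun x => ∑ i, c i * h (x * z i)

section
variable {S : Type*} [Semigroup S] {ι : Type*} [Fintype ι] (c : ι → ℂ)

/-- Averaging over a linear relation. -/
lemma avg {a b r s : ι → ℂ} {k : ℂ} (h : ∀ i, a i + b i = k * r i * s i) :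
    ∑ i, c i * a i + ∑ i, c i * b i = k * ∑ i, c i * (r i * s i) := by
  rw [← Finset.sum_add_distrib, Finset.mul_sum]
  exact Finset.sum_congr rfl fun i _ => by linear_combination c i * h i

lemma sumr (a b : ι → ℂ) (s t : ℂ) :
    ∑ i, c i * (a i * s + b i * t) = (∑ i, c i * a i) * s + (∑ i, c i * b i) * t := by
  rw [Finset.sum_mul, Finset.sum_mul, ← Finset.sum_add_distrib]
  exact Finset.sum_congr rfl fun i _ => by ring

lemma sumrs (a b : ι → ℂ) (s t : ℂ) :
    ∑ i, c i * (a i * s - b i * t) = (∑ i, c i * a i) * s - (∑ i, c i * b i) * t := by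
  rw [Finset.sum_mul, Finset.sum_mul, ← Finset.sum_sub_distrib]
  exact Finset.sum_congr rfl fun i _ => by ring

lemma suml (a b : ι → ℂ) (s t : ℂ) :
    ∑ i, c i * (s * a i + t * b i) = s * (∑ i, c i * a i) + t * (∑ i, c i * b i) := by
  rw [Finset.mul_sum, Finset.mul_sum, ← Finset.sum_add_distrib]
  exact Finset.sum_congr rfl fun i _ => by ring

lemma T_comm (z w : ι → S) (hz : ∀ i x, x * z i = z i * x) (h : S → ℂ) :
    T c w (T c z h) = T c z (T c w h) := by
  funext x
  simp only [T, Finset.mul_sum]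
  rw [Finset.sum_comm]
  refine Finset.sum_congr rfl fun i _ => Finset.sum_congr rfl fun j _ => ?_
  rw [mul_assoc x, mul_assoc x, hz i (w j)]
  ring

lemma eigen (σ : S → S)
    (hσmul : ∀ x y : S, σ (x * y) = σ x * σ y) (hσinv : ∀ x : S, σ (σ x) = x)
    (z : ι → S) (hz : ∀ (i : ι) (x : S), x * z i = z i * x)
    {f g : S → ℂ} (hf : f ≠ 0) (hg : g ≠ 0)
    (E : ∀ x y, T c z f (x * y) + T c z f (σ y * x) = 2 * f x * g y) :
    ∃ κ : ℂ, κ ≠ 0 ∧ ∀ x, T c z f x = κ * f x := by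
  obtain ⟨x0, hx0⟩ := exists_ne hf
  obtain ⟨y0, hy0⟩ := exists_ne hg
  suffices hs : ∃ κ : ℂ, ∀ x, T c z f x = κ * f x by
    obtain ⟨κ, hκ⟩ := hs
    refine ⟨κ, ?_, hκ⟩
    rintro rfl
    have := E x0 y0
    rw [hκ, hκ] at this
    have h2 : f x0 * g y0 = 0 := by linear_combination -this / 2
    exact mul_ne_zero hx0 hy0 h2
  have hzσ : ∀ (i : ι) (x : S), x * σ (z i) = σ (z i) * x := fun i x => by
    have := congrArg σ (hz i (σ x))
    simpa [hσmul, hσinv] using this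
  set w : ι → S := fun i => σ (z i) with hw
  have hww : ∀ i, σ (w i) = z i := fun i => by simp [hw, hσinv]
  -- generic substitutions
  have Tx : ∀ (v : ι → S) (hv : ∀ i x, x * v i = v i * x) (h : S → ℂ) (x y : S),
      T c v h (x * y) = ∑ i, c i * h (x * v i * y) := fun v hv h x y => by
    simp only [T]
    exact Finset.sum_congr rfl fun i _ => by rw [mul_assoc, hv i y, mul_assoc]
  have Ty : ∀ (v : ι → S) (h : S → ℂ) (x y : S),
      T c v h (x * y) = ∑ i, c i * h (x * (y * v i)) := fun v h x y => by
    simp only [T, mul_assoc]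
  have subx : ∀ (v : ι → S) (_ : ∀ i x, x * v i = v i * x) (x y : S),
      T c v (T c z f) (x * y) + T c v (T c z f) (σ y * x) = 2 * (T c v f x * g y) := by
    intro v hv x y
    rw [Tx v hv, Ty v]
    rw [avg c (fun i => E (x * v i) y)]
    simp only [T, Finset.sum_mul, mul_assoc]
  have suby : ∀ (v v' : ι → S) (_ : ∀ i x, x * v' i = v' i * x) (_ : ∀ i, σ (v i) = v' i)
      (x y : S),
      T c v (T c z f) (x * y) + T c v' (T c z f) (σ y * x) = 2 * (f x * T c v g y) := by
    intro v v' hv hvv x y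
    rw [Ty v, Tx v' hv]
    have := avg c (fun i => E x (y * v i))
    simp only [hσmul, hvv] at this
    rw [this]
    congr 1
    simp only [T, Finset.mul_sum]
    exact Finset.sum_congr rfl fun i _ => by ring
  have Ea := subx z hz
  have Ec := subx w hzσ
  have Eb := suby z w hzσ (fun _ => rfl)
  have Ed := suby w z hz hww
  have Eg : ∀ x, T c z (T c z f) x + T c w (T c z f) x = 2 * (f x * ∑ i, c i * g (z i)) := by
    intro x
    have := avg c (fun i => E x (z i))
    rw [← Finset.sum_congr rfl (fun i _ => by rw [← hzσ i x] :
      ∀ i ∈ Finset.univ, c i * T c z f (x * σ (z i)) = c i * T c z f (σ (z i) * x))] at this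
    have e2 : ∑ i, c i * (f x * g (z i)) = f x * ∑ i, c i * g (z i) := by
      rw [Finset.mul_sum]
      exact Finset.sum_congr rfl fun i _ => by ring
    rw [e2] at this
    exact this
  rw [T_comm c z w hz f] at Eb Ec Ed Eg
  generalize hγ : ∑ i, c i * g (z i) = γ at Eg
  have hcross : ∀ x y, (T c z f x + T c w f x) * g y = f x * (T c z g y + T c w g y) :=
    fun x y => by linear_combination (Eb x y + Ed x y - Ea x y - Ec x y) / 2
  obtain ⟨a, haf⟩ : ∃ a : ℂ, ∀ x, T c z f x + T c w f x = a * f x := by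
    refine ⟨(T c z g y0 + T c w g y0) / g y0, fun x => ?_⟩
    have := hcross x y0
    field_simp
    linear_combination this
  have hag : ∀ y, T c z g y + T c w g y = a * g y := fun y => by
    have := hcross x0 y
    rw [haf] at this
    apply mul_left_cancel₀ hx0
    linear_combination -this
  have hTs : ∀ x, T c z (T c z f) x + T c z (T c w f) x = a * T c z f x := fun x => by
    change ∑ i, c i * T c z f (x * z i) + ∑ i, c i * T c w f (x * z i) =
      a * ∑ i, c i * f (x * z i)
    rw [← Finset.sum_add_distrib, Finset.mul_sum]
    exact Finset.sum_congr rfl fun i _ => by linear_combination c i * haf (x * z i)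
  by_cases ha : a = 0
  swap
  · refine ⟨2 * γ / a, fun x => ?_⟩
    have h1 := hTs x
    have h2 := Eg x
    field_simp
    linear_combination h2 - h1
  subst ha
  have H1 : ∀ x y, T c z (T c z f) (x * y) = f x * T c z g y + T c z f x * g y := fun x y => by
    linear_combination Ea x y / 2 + Eb x y / 2 - hTs (σ y * x) / 2
  have H2 : ∀ x y, T c z (T c z f) (σ y * x) = T c z f x * g y - f x * T c z g y := fun x y => by
    linear_combination Ea x y - H1 x y
  have T1 : ∀ x y, T c z (T c z (T c z f)) (x * y) =
      T c z f x * T c z g y + T c z (T c z f) x * g y := fun x y => by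
    rw [Tx z hz]
    simp only [H1]
    exact sumr c _ _ _ _
  have T1' : ∀ x y, T c z (T c z (T c z f)) (x * y) =
      f x * T c z (T c z g) y + T c z f x * T c z g y := fun x y => by
    rw [Ty z]
    simp only [H1]
    exact suml c _ _ _ _
  have T2 : ∀ x y, T c z (T c z (T c z f)) (σ y * x) =
      T c z (T c z f) x * g y - T c z f x * T c z g y := fun x y => by
    rw [Ty z]
    simp only [H2]
    exact sumrs c _ _ _ _
  have hb : ∃ b : ℂ, ∀ x, T c z (T c z f) x = b * f x := by
    refine ⟨T c z (T c z g) y0 / g y0, fun x => ?_⟩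
    have := T1 x y0
    rw [T1'] at this
    field_simp
    linear_combination -this
  obtain ⟨b, hb⟩ := hb
  obtain ⟨κ, hκ⟩ : ∃ κ : ℂ, κ * κ = b := ⟨b ^ (1 / 2 : ℂ), by
    rw [← sq]
    have := Complex.cpow_nat_inv_pow b (two_ne_zero)
    simpa using this⟩
  have hb3 : ∀ x, T c z (T c z (T c z f)) x = b * T c z f x := fun x => by
    have : T c z (T c z f) = fun x => b * f x := funext hb
    rw [this]
    simp only [T, Finset.mul_sum]
    exact Finset.sum_congr rfl fun i _ => by ring
  simp only [hb3, hb] at H1 H2 T1 T2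
  generalize T c z f = F at *
  generalize T c z g = G at *
  by_cases hκ0 : κ = 0
  · refine ⟨-G y0 / g y0, fun x => ?_⟩
    have := H1 x y0
    rw [← hκ, hκ0] at this
    field_simp
    linear_combination -this
  let p : S → ℂ := fun x => f x + F x / κ
  let q : S → ℂ := fun x => f x - F x / κ
  let m : S → ℂ := fun x => (g x + G x / κ) / κ
  let n : S → ℂ := fun x => (g x - G x / κ) / κ
  by_cases hp : p = 0
  · refine ⟨-κ, fun x => ?_⟩
    have := congrFun hp x
    simp only [p, Pi.zero_apply] at this
    field_simp at this
    linear_combination this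
  by_cases hq : q = 0
  · refine ⟨κ, fun x => ?_⟩
    have := congrFun hq x
    simp only [q, Pi.zero_apply] at this
    field_simp at this
    linear_combination -this
  exfalso
  subst hκ
  have e1 : ∀ x y, f (x * y) = (f x * G y + F x * g y) / (κ * κ) := fun x y => by
    rw [← H1]; field_simp
  have e2 : ∀ x y, f (σ y * x) = (F x * g y - f x * G y) / (κ * κ) := fun x y => by
    rw [← H2]; field_simp
  have e3 : ∀ x y, F (x * y) = (F x * G y + κ * κ * f x * g y) / (κ * κ) := fun x y => by
    rw [← T1]; field_simp
  have e4 : ∀ x y, F (σ y * x) = (κ * κ * f x * g y - F x * G y) / (κ * κ) := fun x y => by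
    rw [← T2]; field_simp
  have p1 : ∀ x y, p (x * y) = p x * m y := fun x y => by
    simp only [p, m, e1, e3]; field_simp; ring
  have p2 : ∀ x y, p (σ y * x) = p x * n y := fun x y => by
    simp only [p, n, e2, e4]; field_simp; ring
  have q1 : ∀ x y, q (x * y) = -(q x * n y) := fun x y => by
    simp only [q, n, e1, e3]; field_simp; ring
  have hgmn : ∀ y, g y = κ * (m y + n y) / 2 := fun y => by
    simp only [m, n]; field_simp; ring
  clear_value p q m n
  obtain ⟨u, hu⟩ := exists_ne hp
  obtain ⟨v, hv⟩ := exists_ne hq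
  have n1 : ∀ x y, n (x * y) = n x * n y := fun x y => by
    have e := p2 (σ y * u) x
    rw [← mul_assoc, ← hσmul, p2, p2] at e
    apply mul_left_cancel₀ hu
    linear_combination e
  have n2 : ∀ x y, n (x * y) = -(n x * n y) := fun x y => by
    have e := q1 (v * x) y
    rw [mul_assoc, q1, q1] at e
    apply mul_left_cancel₀ hv
    linear_combination -e
  have n0 : ∀ x, n x = 0 := fun x => by
    have : n x * n x = 0 := by linear_combination (n2 x x - n1 x x) / 2
    exact mul_self_eq_zero.1 this
  have m0 : ∀ x, m x = 0 := fun x => by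
    have e := p2 x (σ u)
    rw [hσinv, n0, p1, mul_zero] at e
    exact (mul_eq_zero.1 e).resolve_left hu
  exact hy0 (by rw [hgmn, n0, m0]; ring)

lemma T_mul (z : ι → S) {χ : S → ℂ} (hχ : ∀ x y, χ (x * y) = χ x * χ y) (x : S) :
    ∑ i, c i * χ (x * z i) = (∑ i, c i * χ (z i)) * χ x := by
  rw [Finset.sum_mul]
  exact Finset.sum_congr rfl fun i _ => by rw [hχ]; ring

lemma T_sine (z : ι → S) {χ φ : S → ℂ} (hφ : ∀ x y, φ (x * y) = φ x * χ y + φ y * χ x) (x : S) :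
    ∑ i, c i * φ (x * z i) = (∑ i, c i * χ (z i)) * φ x + (∑ i, c i * φ (z i)) * χ x := by
  rw [Finset.sum_mul, Finset.sum_mul, ← Finset.sum_add_distrib]
  exact Finset.sum_congr rfl fun i _ => by rw [hφ]; ring

lemma T_lin (z : ι → S) {f u v : S → ℂ} {a b : ℂ} (hf : ∀ x, f x = a * u x + b * v x) (x : S) :
    ∑ i, c i * f (x * z i) = a * ∑ i, c i * u (x * z i) + b * ∑ i, c i * v (x * z i) := by
  rw [Finset.mul_sum, Finset.mul_sum, ← Finset.sum_add_distrib]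
  exact Finset.sum_congr rfl fun i _ => by rw [hf]; ring

end

end KW

/-- Main theorem: complete description of the solutions `(f, g)` with `g ≠ 0` of the
Kannappan–Wilson functional equation
`∑ᵢ cᵢ f(x y zᵢ) + ∑ᵢ cᵢ f(σ(y) x zᵢ) = 2 f(x) g(y)` on a semigroup. -/
theorem kannappan_wilson_solutions {S : Type*} [Semigroup S] (σ : S → S)
    (hσmul : ∀ x y : S, σ (x * y) = σ x * σ y) (hσinv : ∀ x : S, σ (σ x) = x)
    {ι : Type*} [Fintype ι] (c : ι → ℂ) (z : ι → S)
    (hz : ∀ (i : ι) (x : S), x * z i = z i * x)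
    (f g : S → ℂ) (hg : g ≠ 0) :
    (∀ x y : S,
        (∑ i, c i * f (x * y * z i)) + (∑ i, c i * f (σ y * x * z i)) = 2 * f x * g y) ↔
      (f = 0) ∨
      (∃ (m : S → ℂ) (lam₂ : ℂ),
        (∀ x y : S, m (x * y) = m x * m y) ∧ lam₂ ≠ 0 ∧
        (∑ i, c i * m (z i)) ≠ 0 ∧
        (∀ x : S, f x = lam₂ * m x) ∧
        (∀ x : S, g x = (∑ i, c i * m (z i)) * ((m x + m (σ x)) / 2))) ∨
      (∃ (χ : S → ℂ) (α₁ β₁ : ℂ),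
        (∀ x y : S, χ (x * y) = χ x * χ y) ∧ (α₁, β₁) ≠ (0, 0) ∧
        χ ≠ (fun x => χ (σ x)) ∧
        (∑ i, c i * χ (z i)) = (∑ i, c i * χ (σ (z i))) ∧
        (∑ i, c i * χ (z i)) ≠ 0 ∧
        (∀ x : S, f x = α₁ * χ x + β₁ * χ (σ x)) ∧
        (∀ x : S, g x = (∑ i, c i * χ (z i)) * ((χ x + χ (σ x)) / 2))) ∨
      (∃ (χ φ : S → ℂ) (lam γ₁ : ℂ),
        (∀ x y : S, χ (x * y) = χ x * χ y) ∧ χ ≠ 0 ∧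
        φ ≠ 0 ∧ (∀ x y : S, φ (x * y) = φ x * χ y + φ y * χ x) ∧
        lam ≠ 0 ∧
        (∀ x : S, χ (σ x) = χ x) ∧ (∀ x : S, φ (σ x) = -φ x) ∧
        (∑ i, c i * χ (z i)) ≠ 0 ∧ (∑ i, c i * φ (z i)) = 0 ∧
        (∀ x : S, f x = lam * (γ₁ * χ x + φ x)) ∧
        (∀ x : S, g x = (∑ i, c i * χ (z i)) * χ x)) := by
  have hχσ : ∀ χ : S → ℂ, (∀ x y : S, χ (x * y) = χ x * χ y) →
      ∀ x y : S, (fun x => χ (σ x)) (x * y) = (fun x => χ (σ x)) x * (fun x => χ (σ x)) y := by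
    intro χ hχ x y
    simp only [hσmul, hχ]
  have hTσ : ∀ χ : S → ℂ, (∀ x y : S, χ (x * y) = χ x * χ y) → ∀ x,
      ∑ i, c i * χ (σ (x * z i)) = (∑ i, c i * χ (σ (z i))) * χ (σ x) :=
    fun χ hχ x => KW.T_mul c z (χ := fun x => χ (σ x)) (hχσ χ hχ) x
  constructor
  · intro E
    by_cases hf : f = 0
    · exact Or.inl hf
    right
    obtain ⟨κ, hκ, hT⟩ := KW.eigen c σ hσmul hσinv z hz hf hg E
    have hT' : ∀ x, ∑ i, c i * f (x * z i) = κ * f x := hT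
    have hh : (fun x => g x / κ) ≠ 0 := by
      obtain ⟨y, hy⟩ := KW.exists_ne hg
      intro e
      exact div_ne_zero hy hκ (congrFun e y)
    have hW : ∀ x y, f (x * y) + f (σ y * x) = 2 * f x * (fun x => g x / κ) y := by
      intro x y
      have := E x y
      rw [hT', hT'] at this
      field_simp
      linear_combination this
    rcases KW.wilson σ hσmul hσinv hf hh hW with
      ⟨χ, k, l, hχ, hne, hfx, hgx⟩ | ⟨χ, φ, γ, hχ, hχ0, hφ0, hφ, hχs, hφs, hfx, hgx⟩
    · have hgx' : ∀ x, g x = κ * ((χ x + χ (σ x)) / 2) := fun x => by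
        have := hgx x
        rw [← this]
        field_simp
      have hTT : ∀ x, k * ((∑ i, c i * χ (z i)) - κ) * χ x +
          l * ((∑ i, c i * χ (σ (z i))) - κ) * χ (σ x) = 0 := by
        intro x
        have e := hT' x
        rw [KW.T_lin c z (v := fun x => χ (σ x)) hfx, KW.T_mul c z hχ,
          hTσ χ hχ, hfx] at e
        linear_combination e
      by_cases hl : l = 0
      · subst hl
        have hk : k ≠ 0 := by
          rintro rfl
          exact hf (funext fun x => by simp [hfx])
        have hχ0 : χ ≠ 0 := by
          rintro rfl
          exact hf (funext fun x => by simp [hfx])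
        obtain ⟨b, hb⟩ := KW.exists_ne hχ0
        have hM : ∑ i, c i * χ (z i) = κ := by
          have := hTT b
          simp only [zero_mul, add_zero] at this
          exact sub_eq_zero.1
            ((mul_eq_zero.1 ((mul_eq_zero.1 this).resolve_right hb)).resolve_left hk)
        exact Or.inl ⟨χ, k, hχ, hk, by rwa [hM], fun x => by simp [hfx], by rwa [hM]⟩
      have hne := hne hl
      have hχ0 : χ ≠ 0 := by
        rintro rfl
        exact hne rfl
      have hχσ0 : (fun x => χ (σ x)) ≠ 0 := by
        intro e
        exact hχ0 (funext fun x => by simpa [hσinv] using congrFun e (σ x))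
      obtain ⟨i1, i2⟩ := KW.indep hχ (hχσ χ hχ) hχ0 hχσ0 hne hTT
      have hM2 := sub_eq_zero.1 ((mul_eq_zero.1 i2).resolve_left hl)
      by_cases hk : k = 0
      · subst hk
        refine Or.inl ⟨fun x => χ (σ x), l, hχσ χ hχ, hl, by rwa [hM2], fun x => by simp [hfx], ?_⟩
        intro x
        rw [hM2, hgx']
        simp only [hσinv]
        ring
      have hM1 := sub_eq_zero.1 ((mul_eq_zero.1 i1).resolve_left hk)
      refine Or.inr (Or.inl ⟨χ, k, l, hχ, ?_, hne, by rw [hM1, hM2], by rwa [hM1], hfx, by rwa [hM1]⟩)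
      intro e
      exact hk (Prod.mk.inj e).1
    · have hTT : ∀ x, ((∑ i, c i * χ (z i)) - κ) * φ x =
          (γ * (κ - ∑ i, c i * χ (z i)) - ∑ i, c i * φ (z i)) * χ x := by
        intro x
        have e := hT' x
        rw [KW.T_lin c z (a := γ) (b := 1) (u := χ) (v := φ) (fun x => by rw [hfx]; ring),
          KW.T_mul c z hχ, KW.T_sine c z hφ, hfx] at e
        linear_combination e
      obtain ⟨b, hb⟩ := KW.exists_ne hχ0
      obtain ⟨d, hd⟩ := KW.exists_ne hφ0
      have hM : ∑ i, c i * χ (z i) = κ := by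
        by_contra hM
        have hM := sub_ne_zero.2 hM
        generalize (∑ i, c i * χ (z i)) - κ = P at hTT hM
        generalize γ * (κ - ∑ i, c i * χ (z i)) - ∑ i, c i * φ (z i) = Q at hTT
        have e := hTT (b * b)
        rw [hφ, hχ] at e
        have e2 := hTT b
        have e3 : Q * (χ b * χ b) = 0 := by linear_combination e - 2 * χ b * e2
        have hQ := (mul_eq_zero.1 e3).resolve_right (mul_ne_zero hb hb)
        have e4 := hTT d
        rw [hQ, zero_mul] at e4
        exact mul_ne_zero hM hd e4
      have hN : ∑ i, c i * φ (z i) = 0 := by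
        have e := hTT b
        rw [hM] at e
        have : (∑ i, c i * φ (z i)) * χ b = 0 := by linear_combination e
        exact (mul_eq_zero.1 this).resolve_right hb
      refine Or.inr (Or.inr ⟨χ, φ, 1, γ, hχ, hχ0, hφ0, hφ, one_ne_zero, hχs, hφs, by rwa [hM], hN,
        fun x => by rw [hfx]; ring, fun x => ?_⟩)
      rw [hM, ← hgx]
      field_simp
  · rintro (rfl | ⟨m, l, hm, -, -, hfx, hgx⟩ | ⟨χ, k, l, hχ, -, -, hM, -, hfx, hgx⟩ |
      ⟨χ, φ, l, γ, hχ, -, -, hφ, -, hχs, hφs, -, hN, hfx, hgx⟩) x y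
    · simp
    · have hl : ∀ x, f x = l * m x + 0 * m x := fun x => by rw [hfx]; ring
      rw [KW.T_lin c z hl, KW.T_lin c z hl, KW.T_mul c z hm, KW.T_mul c z hm, hfx, hgx, hm, hm]
      ring
    · rw [KW.T_lin c z (v := fun x => χ (σ x)) hfx, KW.T_lin c z (v := fun x => χ (σ x)) hfx,
        KW.T_mul c z hχ, KW.T_mul c z hχ, hTσ χ hχ, hTσ χ hχ,
        ← hM, hfx, hgx]
      simp only [hσmul, hσinv, hχ]
      ring
    · have hl : ∀ x, f x = (l * γ) * χ x + l * φ x := fun x => by rw [hfx]; ring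
      rw [KW.T_lin c z hl, KW.T_lin c z hl, KW.T_mul c z hχ, KW.T_mul c z hχ, KW.T_sine c z hφ,
        KW.T_sine c z hφ, hN, hfx, hgx, hχ, hχ, hφ, hφ, hφs, hχs]
      ring
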